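/- The transitive reduction of a finite DAG is unique: if H₁ and H₂ are both edge-minimal subgraphs of a finite DAG G whose transitive closures equal the transitive closure of G, then H₁ = H₂. -/

import Mathlib

/-- `H` is a transitive reduction of `E`: a subrelation of `E` with the same
transitive closure as `E`, minimal (w.r.t. inclusion) with that property. -/
def IsTransitiveReduction {V : Type*} (E H : V → V → Prop) : Prop :=
  (∀ a b, H a b → E a b) ∧
  Relation.TransGen H = Relation.TransGen E ∧
  ∀ H' : V → V → Prop, (∀ a b, H' a b → H a b) →
    Relation.TransGen H' = Relation.TransGen E → ∀ a b, H a b → H' a b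

open Relation in
theorem tr_cover {V : Type*} (E : V → V → Prop) (hac : ∀ v, ¬ TransGen E v v)
    (H : V → V → Prop) (h : IsTransitiveReduction E H) {a b c : V} (hab : H a b)
    (hac' : TransGen E a c) (hcb : TransGen E c b) : False := by
  obtain ⟨_, hT, hmin⟩ := h
  let K : V → V → Prop := fun x y => H x y ∧ ¬ (x = a ∧ y = b)
  have key : ∀ x y, TransGen H x y →
      TransGen K x y ∨ (ReflTransGen H x a ∧ ReflTransGen H b y) := by
    intro x y hxy
    induction hxy with
    | @single y hy =>
      by_cases hc : x = a ∧ y = b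
      · obtain ⟨rfl, rfl⟩ := hc
        exact Or.inr ⟨.refl, .refl⟩
      · exact Or.inl (.single ⟨hy, hc⟩)
    | @tail y z hxy hyz ih =>
      rcases ih with ih | ⟨h1, h2⟩
      · by_cases hc : y = a ∧ z = b
        · obtain ⟨rfl, rfl⟩ := hc
          exact Or.inr ⟨hxy.to_reflTransGen, .refl⟩
        · exact Or.inl (ih.tail ⟨hyz, hc⟩)
      · exact Or.inr ⟨h1, h2.tail hyz⟩
  rw [← hT] at hac hac' hcb
  have k1 : TransGen K a c := by
    rcases key _ _ hac' with k | ⟨_, k⟩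
    · exact k
    · exact (hac _ (hcb.trans_left k)).elim
  have k2 : TransGen K c b := by
    rcases key _ _ hcb with k | ⟨k, _⟩
    · exact k
    · exact (hac _ (hac'.trans_left k)).elim
  have hK : TransGen K = TransGen E := by
    rw [← hT]
    funext x y
    apply propext
    constructor
    · exact fun t => TransGen.mono (fun _ _ h => h.1) _ _ t
    · intro t
      induction t with
      | @single y hy =>
        by_cases hc : x = a ∧ y = b
        · obtain ⟨rfl, rfl⟩ := hc
          exact k1.trans k2
        · exact .single ⟨hy, hc⟩
      | @tail y z _ hyz ih =>
        by_cases hc : y = a ∧ z = b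
        · obtain ⟨rfl, rfl⟩ := hc
          exact ih.trans (k1.trans k2)
        · exact ih.tail ⟨hyz, hc⟩
  exact (hmin K (fun _ _ h => h.1) hK a b hab).2 ⟨rfl, rfl⟩

open Relation in
theorem tr_sub {V : Type*} (E : V → V → Prop) (hac : ∀ v, ¬ TransGen E v v)
    (H H' : V → V → Prop) (h : IsTransitiveReduction E H)
    (h' : IsTransitiveReduction E H') {a b : V} (hab : H a b) : H' a b := by
  have t : TransGen H' a b := by
    rw [h'.2.1]
    exact .single (h.1 _ _ hab)
  cases t with
  | single k => exact k
  | tail k1 k2 =>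
    rw [h'.2.1] at k1
    exact (tr_cover E hac H h hab k1 (.single (h'.1 _ _ k2))).elim

/-- The transitive reduction of a finite DAG is unique. -/
theorem stmt_10 {V : Type*} [Fintype V] (E : V → V → Prop)
    (hacyclic : ∀ v, ¬ Relation.TransGen E v v)
    (H₁ H₂ : V → V → Prop)
    (h₁ : IsTransitiveReduction E H₁) (h₂ : IsTransitiveReduction E H₂) :
    H₁ = H₂ := by
  funext a b
  exact propext ⟨tr_sub E hacyclic H₁ H₂ h₁ h₂, tr_sub E hacyclic H₂ H₁ h₂ h₁⟩
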